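/- arXiv:1904.03440 — 3 statements merged into one kernel-verified Lean document; each statement's English description precedes it below -/
import Mathlib

section
/- Let β be of class KL and let φ : [0,∞) → [0,∞) be continuous and nondecreasing. Then there exists a function β̂ of class KL such that β(r,s) ≤ β̂(r, s + φ(s)) for all (r,s) ∈ [0,∞) × [0,∞). -/
open MeasureTheory Filter Set
open scoped Classical

noncomputable section

/-- State/input spaces: `ℝ^k` with the Euclidean norm. -/
abbrev Stt (k : ℕ) : Type := EuclideanSpace ℝ (Fin k)

/-- An impulse-time sequence, identified with its (locally finite) set of impulse
times, a subset of `(0,∞)` with finitely many points below any bound. -/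
def IsImpulseSeq (γ : Set ℝ) : Prop :=
  γ ⊆ Set.Ioi (0 : ℝ) ∧ ∀ T : ℝ, (γ ∩ Set.Iic T).Finite

/-- `n^γ_{(s,t]}`: the number of impulse times in the interval `(s,t]`. -/
def nJumps (γ : Set ℝ) (s t : ℝ) : ℕ := (γ ∩ Set.Ioc s t).ncard

/-- Uniform incremental boundedness of a set of impulse-time sequences. -/
def UIB (S : Set (Set ℝ)) : Prop :=
  ∃ φ : ℝ → ℝ, ContinuousOn φ (Set.Ici 0) ∧ MonotoneOn φ (Set.Ici 0) ∧
    (∀ s : ℝ, 0 ≤ s → 0 ≤ φ s) ∧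
    ∀ γ ∈ S, ∀ t0 t : ℝ, 0 ≤ t0 → t0 < t → (nJumps γ t0 t : ℝ) ≤ φ (t - t0)

/-- Class `K∞` functions `[0,∞) → [0,∞)`. -/
def ClassKInf (α : ℝ → ℝ) : Prop :=
  ContinuousOn α (Set.Ici 0) ∧ StrictMonoOn α (Set.Ici 0) ∧ α 0 = 0 ∧
    ∀ M : ℝ, ∃ r : ℝ, 0 ≤ r ∧ M ≤ α r

/-- Class `KL` functions. -/
def ClassKL (β : ℝ → ℝ → ℝ) : Prop :=
  (∀ t : ℝ, 0 ≤ t → ClassKInf fun r => β r t) ∧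
  ∀ r : ℝ, 0 ≤ r → AntitoneOn (fun t => β r t) (Set.Ici 0) ∧
    Filter.Tendsto (fun t => β r t) Filter.atTop (nhds 0)

/-- Positive definite functions `[0,∞) → [0,∞)`. -/
def PosDef (ρ : ℝ → ℝ) : Prop :=
  ContinuousOn ρ (Set.Ici 0) ∧ ρ 0 = 0 ∧ ∀ r : ℝ, 0 < r → 0 < ρ r

/-- Locally integrable (on compacts) function `[0,∞) → ℝ` (extended to `ℝ`). -/
def LocIntegrable (p : ℝ → ℝ) : Prop :=
  ∀ a b : ℝ, MeasureTheory.IntegrableOn p (Set.Icc a b)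

/-- Inputs: measurable, locally essentially bounded functions. -/
def IsInput {m : ℕ} (u : ℝ → Stt m) : Prop :=
  Measurable u ∧ ∀ T : ℝ, ∃ C : ℝ, ∀ᵐ t ∂MeasureTheory.volume, t ∈ Set.Icc 0 T → ‖u t‖ ≤ C

/-- `‖u_I‖_γ`: max of the essential supremum of `‖u‖` over `I` and the supremum of
`‖u‖` over `γ ∩ I`. -/
def inputNorm {m : ℕ} (γ : Set ℝ) (u : ℝ → Stt m) (I : Set ℝ) : ℝ :=
  max (essSup (fun t => ‖u t‖) (MeasureTheory.volume.restrict I))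
      (sSup ((fun t => ‖u t‖) '' (γ ∩ I)))

/-- Solution of the impulsive system `(γ,f,g)` on `[t0,T)` with initial state `x0`
and input `u` (Carathéodory solutions, in integral form, between impulses). -/
structure IsSolution {n m : ℕ} (γ : Set ℝ) (f g : ℝ → Stt n → Stt m → Stt n)
    (t0 : ℝ) (x0 : Stt n) (u : ℝ → Stt m) (T : EReal) (x : ℝ → Stt n) : Prop where
  lt : (t0 : EReal) < T
  init : x t0 = x0
  flow : ∀ t1 t2 : ℝ, t0 ≤ t1 → t1 ≤ t2 → (t2 : EReal) < T → Set.Ioc t1 t2 ∩ γ = ∅ →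
    MeasureTheory.IntegrableOn (fun s => f s (x s) (u s)) (Set.Icc t1 t2) ∧
    x t2 = x t1 + ∫ s in t1..t2, f s (x s) (u s)
  jump : ∀ t ∈ γ, t0 < t → (t : EReal) < T →
    ∃ L : Stt n, Filter.Tendsto x (nhdsWithin t (Set.Iio t)) (nhds L) ∧
      x t = L + g t L (u t)

/-- Maximally defined solution. -/
def IsMaxSolution {n m : ℕ} (γ : Set ℝ) (f g : ℝ → Stt n → Stt m → Stt n)
    (t0 : ℝ) (x0 : Stt n) (u : ℝ → Stt m) (T : EReal) (x : ℝ → Stt n) : Prop :=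
  IsSolution γ f g t0 x0 u T x ∧
    ∀ (T' : EReal) (x' : ℝ → Stt n), IsSolution γ f g t0 x0 u T' x' →
      (∀ t : ℝ, t0 ≤ t → (t : EReal) < T → x' t = x t) → T' ≤ T

/-- Weak `(h⁰,h)`-ISS of a parametrized family of impulsive systems. -/
def WeaklyISS {n m : ℕ} {Λ : Type*} (γ : Λ → Set ℝ)
    (f g : Λ → ℝ → Stt n → Stt m → Stt n) (h0 h : ℝ → Stt n → ℝ) : Prop :=
  ∃ β : ℝ → ℝ → ℝ, ∃ ρ : ℝ → ℝ, ClassKL β ∧ ClassKInf ρ ∧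
    ∀ (l : Λ) (t0 : ℝ) (x0 : Stt n) (u : ℝ → Stt m) (T : EReal) (x : ℝ → Stt n),
      0 ≤ t0 → IsInput u → IsMaxSolution (γ l) (f l) (g l) t0 x0 u T x →
      ∀ t : ℝ, t0 ≤ t → (t : EReal) < T →
        h t (x t) ≤ β (h0 t0 x0) (t - t0) + ρ (inputNorm (γ l) u (Set.Ioc t0 t))

/-- Strong `(h⁰,h)`-ISS of a parametrized family of impulsive systems. -/
def StronglyISS {n m : ℕ} {Λ : Type*} (γ : Λ → Set ℝ)
    (f g : Λ → ℝ → Stt n → Stt m → Stt n) (h0 h : ℝ → Stt n → ℝ) : Prop :=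
  ∃ β : ℝ → ℝ → ℝ, ∃ ρ : ℝ → ℝ, ClassKL β ∧ ClassKInf ρ ∧
    ∀ (l : Λ) (t0 : ℝ) (x0 : Stt n) (u : ℝ → Stt m) (T : EReal) (x : ℝ → Stt n),
      0 ≤ t0 → IsInput u → IsMaxSolution (γ l) (f l) (g l) t0 x0 u T x →
      ∀ t : ℝ, t0 ≤ t → (t : EReal) < T →
        h t (x t) ≤ β (h0 t0 x0) (t - t0 + (nJumps (γ l) t0 t : ℝ)) +
          ρ (inputNorm (γ l) u (Set.Ioc t0 t))

/-- Locally Lipschitz on a set. -/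
def LocLipschitzOn {α β : Type*} [PseudoEMetricSpace α] [PseudoEMetricSpace β]
    (s : Set α) (f : α → β) : Prop :=
  ∀ x ∈ s, ∃ K : NNReal, ∃ t ∈ nhdsWithin x s, LipschitzOnWith K f t

/-- `V ∈ V(γ)` with `Vm` its left-limit function at impulse times: `V` is locally
Lipschitz on each inter-impulse strip and has the joint left limit `Vm τ ξ`
at each `τ ∈ γ`. -/
def InClassV {n : ℕ} (γ : Set ℝ) (V Vm : ℝ → Stt n → ℝ) : Prop :=
  (∀ a b : ℝ, 0 ≤ a → Set.Ioo a b ∩ γ = ∅ →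
    LocLipschitzOn (Set.Ico a b ×ˢ (Set.univ : Set (Stt n)))
      (fun q : ℝ × Stt n => V q.1 q.2)) ∧
  ∀ τ ∈ γ, ∀ ξ : Stt n,
    Filter.Tendsto (fun q : ℝ × Stt n => V q.1 q.2)
      (nhdsWithin (τ, ξ) (Set.Iio τ ×ˢ (Set.univ : Set (Stt n)))) (nhds (Vm τ ξ))

/-- Upper-right Dini derivative of `V` along the flow map `f`. -/
def DiniAlong {n m : ℕ} (f : ℝ → Stt n → Stt m → Stt n) (V : ℝ → Stt n → ℝ)
    (t : ℝ) (ξ : Stt n) (μ : Stt m) : ℝ :=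
  Filter.limsup (fun d : ℝ => (V (t + d) (ξ + d • f t ξ μ) - V t ξ) / d)
    (nhdsWithin 0 (Set.Ioi 0))

/-- Carathéodory function `[0,∞) × [0,∞) → ℝ`. -/
def Caratheodory2 (φ : ℝ → ℝ → ℝ) : Prop :=
  (∀ r : ℝ, Measurable fun t => φ t r) ∧
  (∀ t : ℝ, ContinuousOn (φ t) (Set.Ici 0)) ∧
  ∀ a b c : ℝ, ∃ mK : ℝ → ℝ, MeasureTheory.IntegrableOn mK (Set.Icc a b) ∧
    ∀ t ∈ Set.Icc a b, ∀ r ∈ Set.Icc (0 : ℝ) c, |φ t r| ≤ mK t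

/-- Assumption 1 of the paper, with all the data explicit. -/
def Assumption1 {n m : ℕ} {Λ : Type*} (γ : Λ → Set ℝ)
    (f g : Λ → ℝ → Stt n → Stt m → Stt n) (h0 h : ℝ → Stt n → ℝ)
    (V Vm : Λ → ℝ → Stt n → ℝ) (φ1 φ2 χ π : ℝ → ℝ)
    (vφ al : Λ → ℝ → ℝ → ℝ) : Prop :=
  ClassKInf φ1 ∧ ClassKInf φ2 ∧ ClassKInf χ ∧ ClassKInf π ∧
  (∀ l : Λ, InClassV (γ l) (V l) (Vm l)) ∧
  (∀ l : Λ, Caratheodory2 (vφ l)) ∧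
  (∀ (l : Λ) (t r : ℝ), 0 ≤ t → 0 ≤ r → 0 ≤ al l t r) ∧
  (∀ (l : Λ) (t : ℝ) (ξ : Stt n), 0 ≤ t →
    φ1 (h t ξ) ≤ V l t ξ ∧ V l t ξ ≤ φ2 (h0 t ξ)) ∧
  (∀ (l : Λ) (t : ℝ) (ξ : Stt n) (μ : Stt m), 0 ≤ t → t ∉ γ l → χ ‖μ‖ ≤ V l t ξ →
    DiniAlong (f l) (V l) t ξ μ ≤ - vφ l t (V l t ξ)) ∧
  (∀ (l : Λ) (t : ℝ) (ξ : Stt n) (μ : Stt m), t ∈ γ l → χ ‖μ‖ ≤ Vm l t ξ →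
    V l t (ξ + g l t ξ μ) ≤ al l t (Vm l t ξ)) ∧
  (∀ (l : Λ) (t : ℝ) (ξ : Stt n) (μ : Stt m), t ∈ γ l → Vm l t ξ ≤ χ ‖μ‖ →
    V l t (ξ + g l t ξ μ) ≤ π ‖μ‖)

/-- Solution of the scalar comparison differential/difference inclusion. -/
structure IsCompSol (γ : Set ℝ) (vφ al : ℝ → ℝ → ℝ) (t0 z0 : ℝ) (T : EReal)
    (z : ℝ → ℝ) : Prop where
  lt : (t0 : EReal) < T
  init : z t0 = z0
  nonneg : ∀ t : ℝ, t0 ≤ t → (t : EReal) < T → 0 ≤ z t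
  flow : ∀ t1 t2 : ℝ, t0 ≤ t1 → t1 ≤ t2 → (t2 : EReal) < T → Set.Ioc t1 t2 ∩ γ = ∅ →
    ∃ d : ℝ → ℝ, MeasureTheory.IntegrableOn d (Set.Icc t1 t2) ∧
      (∀ᵐ s ∂MeasureTheory.volume, s ∈ Set.Icc t1 t2 → d s ≤ - vφ s (z s)) ∧
      ∀ t ∈ Set.Icc t1 t2, z t = z t1 + ∫ s in t1..t, d s
  jump : ∀ t ∈ γ, t0 < t → (t : EReal) < T →
    ∃ L : ℝ, Filter.Tendsto z (nhdsWithin t (Set.Iio t)) (nhds L) ∧ z t ≤ al t L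

/-- The family of comparison systems is weakly GUAS. -/
def CompWeakGUAS {Λ : Type*} (γ : Λ → Set ℝ) (vφ al : Λ → ℝ → ℝ → ℝ) : Prop :=
  ∃ β : ℝ → ℝ → ℝ, ClassKL β ∧
    ∀ (l : Λ) (t0 z0 : ℝ) (T : EReal) (z : ℝ → ℝ), 0 ≤ t0 → 0 ≤ z0 →
      IsCompSol (γ l) (vφ l) (al l) t0 z0 T z →
      ∀ t : ℝ, t0 ≤ t → (t : EReal) < T → z t ≤ β z0 (t - t0)

/-- The family of comparison systems is strongly GUAS. -/
def CompStrongGUAS {Λ : Type*} (γ : Λ → Set ℝ) (vφ al : Λ → ℝ → ℝ → ℝ) : Prop :=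
  ∃ β : ℝ → ℝ → ℝ, ClassKL β ∧
    ∀ (l : Λ) (t0 z0 : ℝ) (T : EReal) (z : ℝ → ℝ), 0 ≤ t0 → 0 ≤ z0 →
      IsCompSol (γ l) (vφ l) (al l) t0 z0 T z →
      ∀ t : ℝ, t0 ≤ t → (t : EReal) < T → z t ≤ β z0 (t - t0 + (nJumps (γ l) t0 t : ℝ))

/-- Nonnegative Carathéodory solution of the scalar ODE `ẇ = rhs(t,w)` on `[t0,T)`. -/
structure IsODESol (rhs : ℝ → ℝ → ℝ) (t0 : ℝ) (T : EReal) (w : ℝ → ℝ) : Prop where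
  lt : (t0 : EReal) < T
  nonneg : ∀ t : ℝ, t0 ≤ t → (t : EReal) < T → 0 ≤ w t
  flow : ∀ t1 t2 : ℝ, t0 ≤ t1 → t1 ≤ t2 → (t2 : EReal) < T →
    IntervalIntegrable (fun s => rhs s (w s)) MeasureTheory.volume t1 t2 ∧
    w t2 = w t1 + ∫ s in t1..t2, rhs s (w s)

/-- Maximally defined forward-in-time solution of `ẇ = rhs(t,w)`. -/
def IsMaxODESol (rhs : ℝ → ℝ → ℝ) (t0 : ℝ) (T : EReal) (w : ℝ → ℝ) : Prop :=
  IsODESol rhs t0 T w ∧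
    ∀ (T' : EReal) (w' : ℝ → ℝ), IsODESol rhs t0 T' w' →
      (∀ t : ℝ, t0 ≤ t → (t : EReal) < T → w' t = w t) → T' ≤ T

/-- GUAS of the family of scalar ODEs `ẇ = −φ_λ(t,w)`. -/
def ODEFamilyGUAS {Λ : Type*} (vφ : Λ → ℝ → ℝ → ℝ) : Prop :=
  ∃ β : ℝ → ℝ → ℝ, ClassKL β ∧
    ∀ (l : Λ) (t0 : ℝ) (T : EReal) (w : ℝ → ℝ), 0 ≤ t0 →
      IsMaxODESol (fun s r => -(vφ l s r)) t0 T w →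
      T = (⊤ : EReal) ∧ ∀ t : ℝ, t0 ≤ t → w t ≤ β (w t0) (t - t0)

/-- Solution (on all of `[0,∞)`) of the scalar linear ODE `ẇ = −p(t)·w`. -/
def IsLinSol (p : ℝ → ℝ) (w : ℝ → ℝ) : Prop :=
  ∀ t1 t2 : ℝ, 0 ≤ t1 → t1 ≤ t2 →
    IntervalIntegrable (fun s => p s * w s) MeasureTheory.volume t1 t2 ∧
    w t2 = w t1 + ∫ s in t1..t2, -(p s * w s)

/-- An impulsive and switching sequence, described through its impulse-time set,
its two switching signals (constant between impulses), and the left limit of the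
first switching signal at impulse times. -/
structure SwSignal (Ic Id : Type*) where
  γ : Set ℝ
  σ1 : ℝ → Ic
  σ1m : ℝ → Ic
  σ2 : ℝ → Id
  impulse : IsImpulseSeq γ
  const1 : ∀ a b : ℝ, 0 ≤ a → Set.Ioo a b ∩ γ = ∅ → ∀ t ∈ Set.Ico a b, σ1 t = σ1 a
  const2 : ∀ a b : ℝ, 0 ≤ a → Set.Ioo a b ∩ γ = ∅ → ∀ t ∈ Set.Ico a b, σ2 t = σ2 a
  leftlim : ∀ t ∈ γ, ∀ᶠ s in nhdsWithin t (Set.Iio t), σ1 s = σ1m t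

/-- `σ ∈ SW(J)`. -/
def InSW {Ic Id : Type*} (σ : SwSignal Ic Id) (J : Set (Ic × Ic × Id)) : Prop :=
  ∀ t ∈ σ.γ, (σ.σ1m t, σ.σ1 t, σ.σ2 t) ∈ J

/-- Flow map of the switched impulsive system `Σ_σ`. -/
def swF {n m : ℕ} {Ic Id : Type*} (F : Ic → ℝ → Stt n → Stt m → Stt n)
    (σ : SwSignal Ic Id) : ℝ → Stt n → Stt m → Stt n :=
  fun t ξ μ => F (σ.σ1 t) t ξ μ

/-- Jump map of the switched impulsive system `Σ_σ`. -/
def swG {n m : ℕ} {Ic Id : Type*} (G : Id → ℝ → Stt n → Stt m → Stt n)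
    (σ : SwSignal Ic Id) : ℝ → Stt n → Stt m → Stt n :=
  fun t ξ μ => G (σ.σ2 t) t ξ μ

/-- Weak `(h⁰,h)`-ISS of the family `{Σ_σ}_{σ ∈ SW}`. -/
def SwWeaklyISS {n m : ℕ} {Ic Id : Type*} (F : Ic → ℝ → Stt n → Stt m → Stt n)
    (G : Id → ℝ → Stt n → Stt m → Stt n) (SW : Set (SwSignal Ic Id))
    (h0 h : ℝ → Stt n → ℝ) : Prop :=
  ∃ β : ℝ → ℝ → ℝ, ∃ ρ : ℝ → ℝ, ClassKL β ∧ ClassKInf ρ ∧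
    ∀ σ ∈ SW, ∀ (t0 : ℝ) (x0 : Stt n) (u : ℝ → Stt m) (T : EReal) (x : ℝ → Stt n),
      0 ≤ t0 → IsInput u → IsMaxSolution σ.γ (swF F σ) (swG G σ) t0 x0 u T x →
      ∀ t : ℝ, t0 ≤ t → (t : EReal) < T →
        h t (x t) ≤ β (h0 t0 x0) (t - t0) + ρ (inputNorm σ.γ u (Set.Ioc t0 t))

/-- Strong `(h⁰,h)`-ISS of the family `{Σ_σ}_{σ ∈ SW}`. -/
def SwStronglyISS {n m : ℕ} {Ic Id : Type*} (F : Ic → ℝ → Stt n → Stt m → Stt n)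
    (G : Id → ℝ → Stt n → Stt m → Stt n) (SW : Set (SwSignal Ic Id))
    (h0 h : ℝ → Stt n → ℝ) : Prop :=
  ∃ β : ℝ → ℝ → ℝ, ∃ ρ : ℝ → ℝ, ClassKL β ∧ ClassKInf ρ ∧
    ∀ σ ∈ SW, ∀ (t0 : ℝ) (x0 : Stt n) (u : ℝ → Stt m) (T : EReal) (x : ℝ → Stt n),
      0 ≤ t0 → IsInput u → IsMaxSolution σ.γ (swF F σ) (swG G σ) t0 x0 u T x →
      ∀ t : ℝ, t0 ≤ t → (t : EReal) < T →
        h t (x t) ≤ β (h0 t0 x0) (t - t0 + (nJumps σ.γ t0 t : ℝ)) +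
          ρ (inputNorm σ.γ u (Set.Ioc t0 t))

/-- Total activation time in `(t0,t]` of the flow modes in `A`. -/
def actT {Ic Id : Type*} (σ : SwSignal Ic Id) (A : Set Ic) (t0 t : ℝ) : ℝ :=
  (MeasureTheory.volume {r : ℝ | r ∈ Set.Ioc t0 t ∧ σ.σ1 r ∈ A}).toReal

/-- Number of impulse times in `(t0,t]` whose mode combination lies in `Jp`. -/
def nJumpsIn {Ic Id : Type*} (σ : SwSignal Ic Id) (Jp : Set (Ic × Ic × Id))
    (t0 t : ℝ) : ℕ :=
  (σ.γ ∩ Set.Ioc t0 t ∩ {r : ℝ | (σ.σ1m r, σ.σ1 r, σ.σ2 r) ∈ Jp}).ncard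

/-- Assumption 2 of the paper (for switched impulsive systems), data explicit. -/
def Assumption2 {n m : ℕ} {Ic Id : Type*}
    (F : Ic → ℝ → Stt n → Stt m → Stt n) (G : Id → ℝ → Stt n → Stt m → Stt n)
    (h0 h : ℝ → Stt n → ℝ) (J : Set (Ic × Ic × Id))
    (v : Ic → ℝ → Stt n → ℝ) (φ1 φ2 χ π : ℝ → ℝ)
    (vφ : Ic → ℝ → ℝ → ℝ) (al : Ic × Ic × Id → ℝ → ℝ → ℝ) : Prop :=
  ClassKInf φ1 ∧ ClassKInf φ2 ∧ ClassKInf χ ∧ ClassKInf π ∧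
  (∀ i : Ic, LocLipschitzOn ((Set.Ici (0 : ℝ)) ×ˢ (Set.univ : Set (Stt n)))
      (fun q : ℝ × Stt n => v i q.1 q.2)) ∧
  (∀ i : Ic, Caratheodory2 (vφ i)) ∧
  (∀ e ∈ J, ∀ t r : ℝ, 0 ≤ t → 0 ≤ r → 0 ≤ al e t r) ∧
  (∀ (i : Ic) (t : ℝ) (ξ : Stt n), 0 ≤ t →
    φ1 (h t ξ) ≤ v i t ξ ∧ v i t ξ ≤ φ2 (h0 t ξ)) ∧
  (∀ (i : Ic) (t : ℝ) (ξ : Stt n) (μ : Stt m), 0 ≤ t → χ ‖μ‖ ≤ v i t ξ →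
    DiniAlong (F i) (v i) t ξ μ ≤ - vφ i t (v i t ξ)) ∧
  (∀ (ι i : Ic) (j : Id), (ι, i, j) ∈ J → ∀ (t : ℝ) (ξ : Stt n) (μ : Stt m),
    0 ≤ t → χ ‖μ‖ ≤ v ι t ξ → v i t (ξ + G j t ξ μ) ≤ al (ι, i, j) t (v ι t ξ)) ∧
  (∀ (ι i : Ic) (j : Id), (ι, i, j) ∈ J → ∀ (t : ℝ) (ξ : Stt n) (μ : Stt m),
    0 ≤ t → v ι t ξ ≤ χ ‖μ‖ → v i t (ξ + G j t ξ μ) ≤ π ‖μ‖)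

/-- A monotone left inverse on `[0,∞)` of `s ↦ s + φ s`, tending to infinity. -/
theorem exists_monotone_leftInverse_add {φ : ℝ → ℝ} (hφm : MonotoneOn φ (Set.Ici 0))
    (hφnn : ∀ s : ℝ, 0 ≤ s → 0 ≤ φ s) :
    ∃ τ : ℝ → ℝ, Monotone τ ∧ (∀ t, 0 ≤ τ t) ∧ Filter.Tendsto τ Filter.atTop Filter.atTop ∧
      ∀ s : ℝ, 0 ≤ s → τ (s + φ s) = s := by
  let A : ℝ → Set ℝ := fun t => {s | 0 ≤ s ∧ (s = 0 ∨ s + φ s ≤ t)}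
  have hzero : ∀ t, (0 : ℝ) ∈ A t := fun t => ⟨le_rfl, Or.inl rfl⟩
  have hbdd : ∀ t, BddAbove (A t) := by
    refine fun t => ⟨max 0 t, ?_⟩
    rintro s ⟨hs, rfl | hst⟩
    · exact le_max_left _ _
    · exact le_max_of_le_right (by linarith [hφnn s hs])
  have hmono : Monotone fun t => sSup (A t) := fun t₁ t₂ ht =>
    csSup_le_csSup (hbdd t₂) ⟨0, hzero t₁⟩ fun s hs => ⟨hs.1, hs.2.imp_right fun h => h.trans ht⟩
  have hinv : ∀ s : ℝ, 0 ≤ s → sSup (A (s + φ s)) = s := by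
    intro s hs
    refine le_antisymm (csSup_le ⟨0, hzero _⟩ ?_) (le_csSup (hbdd _) ⟨hs, Or.inr le_rfl⟩)
    rintro s' ⟨hs', rfl | hle⟩
    · exact hs
    · by_contra! hlt
      linarith [hφm hs hs' hlt.le]
  refine ⟨fun t => sSup (A t), hmono, fun t => le_csSup (hbdd t) (hzero t), ?_, hinv⟩
  refine Filter.tendsto_atTop_atTop.2 fun b => ⟨max b 0 + φ (max b 0), fun t ht => ?_⟩
  calc b ≤ max b 0 := le_max_left _ _
    _ = sSup (A (max b 0 + φ (max b 0))) := (hinv _ (le_max_right _ _)).symm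
    _ ≤ sSup (A t) := hmono ht

/-- Class `KL` is stable under monotone divergent time changes. -/
theorem ClassKL.comp_time {β : ℝ → ℝ → ℝ} (hβ : ClassKL β) {τ : ℝ → ℝ} (hτ : Monotone τ)
    (hτ0 : ∀ t, 0 ≤ τ t) (hτtop : Filter.Tendsto τ Filter.atTop Filter.atTop) :
    ClassKL fun r t => β r (τ t) :=
  ⟨fun t _ => hβ.1 (τ t) (hτ0 t), fun r hr =>
    ⟨fun _ _ _ _ h => (hβ.2 r hr).1 (hτ0 _) (hτ0 _) (hτ h), (hβ.2 r hr).2.comp hτtop⟩⟩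

/-- Lemma 1: a `KL` bound can be absorbed into a `KL` function of `s + φ(s)`. -/
theorem stmt14 (β : ℝ → ℝ → ℝ) (hβ : ClassKL β) (φ : ℝ → ℝ)
    (hφc : ContinuousOn φ (Set.Ici 0)) (hφm : MonotoneOn φ (Set.Ici 0))
    (hφnn : ∀ s : ℝ, 0 ≤ s → 0 ≤ φ s) :
    ∃ βh : ℝ → ℝ → ℝ, ClassKL βh ∧
      ∀ r s : ℝ, 0 ≤ r → 0 ≤ s → β r s ≤ βh r (s + φ s) := by
  obtain ⟨τ, hτ, hτ0, hτtop, hinv⟩ := exists_monotone_leftInverse_add hφm hφnn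
  exact ⟨fun r t => β r (τ t), hβ.comp_time hτ hτ0 hτtop, fun r s _ hs => by simp [hinv s hs]⟩

end
end

section
/- Let φ : [0,∞) → [0,∞) and α : [0,∞) → [0,∞) be continuous and positive definite, let p : [0,∞) → [0,∞) be locally integrable and let θ > 0. Suppose that sup_{a>0} ∫_a^{α(a)} ds/φ(s) < inf_{t≥0} ∫_t^{t+θ} p(s) ds =: M, with M > 0. Then there exists ᾱ of class K∞ with α(a) ≤ ᾱ(a) for all a ≥ 0 such that sup_{a>0} ∫_a^{ᾱ(a)} ds/φ(s) < M. -/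
open MeasureTheory Filter Set
open scoped Classical

noncomputable section

section PositiveDefinite

variable {φ α : ℝ → ℝ}

lemma PosDef.intervalIntegrable_inv (hφ : PosDef φ) {a b : ℝ} (ha : 0 < a) (hb : 0 < b) :
    IntervalIntegrable (fun s => (φ s)⁻¹) volume a b := by
  have hpos : ∀ x ∈ uIcc a b, 0 < x := fun x hx => (lt_min ha hb).trans_le hx.1
  exact ContinuousOn.intervalIntegrable
    ((hφ.1.mono fun x hx => (hpos x hx).le).inv₀ fun x hx => (hφ.2.2 x (hpos x hx)).ne')

lemma PosDef.integral_inv_nonneg (hφ : PosDef φ) {a b : ℝ} (ha : 0 < a) (hab : a ≤ b) :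
    0 ≤ ∫ s in a..b, (φ s)⁻¹ :=
  intervalIntegral.integral_nonneg hab fun s hs =>
    (inv_pos.2 (hφ.2.2 s (ha.trans_le hs.1))).le

lemma PosDef.integral_inv_add (hφ : PosDef φ) {a b c : ℝ} (ha : 0 < a) (hb : 0 < b)
    (hc : 0 < c) :
    (∫ s in a..b, (φ s)⁻¹) + ∫ s in b..c, (φ s)⁻¹ = ∫ s in a..c, (φ s)⁻¹ :=
  intervalIntegral.integral_add_adjacent_intervals
    (hφ.intervalIntegrable_inv ha hb) (hφ.intervalIntegrable_inv hb hc)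

lemma PosDef.continuousOn_integral_inv (hφ : PosDef φ) :
    ContinuousOn (fun x => ∫ s in (1 : ℝ)..x, (φ s)⁻¹) (Ioi 0) := by
  intro x hx
  have hx : 0 < x := hx
  have hcont : ContinuousOn (fun s => (φ s)⁻¹) (Ioi 0) :=
    (hφ.1.mono Ioi_subset_Ici_self).inv₀ fun s hs => (hφ.2.2 s hs).ne'
  exact (intervalIntegral.integral_hasDerivAt_right
    (hφ.intervalIntegrable_inv one_pos hx)
    (hcont.stronglyMeasurableAtFilter isOpen_Ioi x hx)
    (hcont.continuousAt (Ioi_mem_nhds hx))).continuousAt.continuousWithinAt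

/-- In the logarithmic coordinate, the antiderivative of `1 / φ` plus the identity is an
increasing bijection of the real line. -/
lemma PosDef.exists_orderIso (hφ : PosDef φ) :
    ∃ H : ℝ ≃o ℝ, ∀ u : ℝ, H u = (∫ s in (1 : ℝ)..Real.exp u, (φ s)⁻¹) + u := by
  set f : ℝ → ℝ := fun u => (∫ s in (1 : ℝ)..Real.exp u, (φ s)⁻¹) + u with hf
  have hincr : ∀ {u v : ℝ}, u ≤ v → v - u ≤ f v - f u := by
    intro u v huv
    have hadd := hφ.integral_inv_add one_pos (Real.exp_pos u) (Real.exp_pos v)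
    have hnn := hφ.integral_inv_nonneg (Real.exp_pos u) (Real.exp_le_exp.2 huv)
    simp only [hf]
    linarith
  have hmono : StrictMono f := fun u v huv => by linarith [hincr huv.le]
  have hcont : Continuous f := by
    refine Continuous.add ?_ continuous_id
    exact hφ.continuousOn_integral_inv.comp_continuous Real.continuous_exp Real.exp_pos
  have htop : Tendsto f atTop atTop := by
    refine tendsto_atTop_mono' _ ?_ (tendsto_atTop_add_const_right _ (f 0) tendsto_id)
    filter_upwards [eventually_ge_atTop 0] with u hu
    have := hincr hu
    simp only [id]
    linarith
  have hbot : Tendsto f atBot atBot := by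
    refine tendsto_atBot_mono' _ ?_ (tendsto_atBot_add_const_right _ (f 0) tendsto_id)
    filter_upwards [eventually_le_atBot 0] with u hu
    have := hincr hu
    simp only [id]
    linarith
  exact ⟨hmono.orderIsoOfSurjective f (hcont.surjective htop hbot), fun u => rfl⟩

/-- A continuous nondecreasing function above the identity has a `K∞` majorant which is
arbitrarily close to it in the metric `ds / φ`. -/
lemma PosDef.exists_classKInf_ge (hφ : PosDef φ) {β : ℝ → ℝ} (hβc : ContinuousOn β (Ici 0))
    (hβm : MonotoneOn β (Ici 0)) (hβ0 : β 0 = 0) (hβid : ∀ a, 0 ≤ a → a ≤ β a)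
    {ε : ℝ} (hε : 0 < ε) :
    ∃ αb : ℝ → ℝ, ClassKInf αb ∧ (∀ a, 0 ≤ a → β a ≤ αb a) ∧
      ∀ a, 0 < a → ∫ s in (β a)..(αb a), (φ s)⁻¹ ≤ ε := by
  obtain ⟨H, hH⟩ := hφ.exists_orderIso
  have hβpos : ∀ {a}, 0 < a → 0 < β a := fun {a} ha => ha.trans_le (hβid a ha.le)
  have hexp : ∀ {a}, 0 < a → Real.exp (Real.log (β a)) = β a := fun ha =>
    Real.exp_log (hβpos ha)
  set g : ℝ → ℝ := fun a => H (Real.log (β a)) + ε * (1 - (1 + a)⁻¹) with hg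
  set αb : ℝ → ℝ := fun a => if a = 0 then 0 else Real.exp (H.symm (g a)) with hαb
  have hα0 : αb 0 = 0 := by simp [hαb]
  have hαpos : ∀ {a}, 0 < a → αb a = Real.exp (H.symm (g a)) := fun ha => by
    simp [hαb, ha.ne']
  have hη : ∀ {a : ℝ}, 0 < a → 0 ≤ 1 - (1 + a)⁻¹ := fun {a} ha =>
    sub_nonneg.2 (inv_le_one_of_one_le₀ (by linarith))
  have hlog : ∀ {a}, 0 < a → Real.log (β a) ≤ H.symm (g a) := fun {a} ha => by
    rw [H.le_symm_apply]
    have := mul_nonneg hε.le (hη ha)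
    simp only [hg]
    linarith
  have hge : ∀ a, 0 ≤ a → β a ≤ αb a := by
    intro a ha
    rcases ha.eq_or_lt with rfl | ha
    · rw [hα0, hβ0]
    · rw [hαpos ha, ← Real.log_le_iff_le_exp (hβpos ha)]
      exact hlog ha
  have hgmono : StrictMonoOn g (Ioi 0) := by
    intro a ha b hb hab
    have ha : 0 < a := ha
    have hb : 0 < b := hb
    have h1 : H (Real.log (β a)) ≤ H (Real.log (β b)) :=
      H.monotone (Real.log_le_log (hβpos ha) (hβm ha.le hb.le hab.le))
    have h2 : (1 + b)⁻¹ < (1 + a)⁻¹ := inv_strictAnti₀ (by linarith) (by linarith)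
    have h3 := mul_lt_mul_of_pos_left h2 hε
    simp only [hg]
    linarith
  have hgbot : Tendsto g (nhdsWithin 0 (Ioi 0)) atBot := by
    have hβ : Tendsto β (nhdsWithin 0 (Ioi 0)) (nhdsWithin 0 (Ioi 0)) := by
      refine tendsto_nhdsWithin_iff.2 ⟨?_, eventually_mem_nhdsWithin.mono fun a ha => hβpos ha⟩
      have := (hβc 0 self_mem_Ici).mono_left (nhdsWithin_mono 0 Ioi_subset_Ici_self)
      rwa [hβ0] at this
    have h1 : Tendsto (fun a => H (Real.log (β a))) (nhdsWithin 0 (Ioi 0)) atBot :=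
      H.tendsto_atBot.comp (Real.tendsto_log_nhdsGT_zero.comp hβ)
    refine tendsto_atBot_mono' _ ?_ (tendsto_atBot_add_const_right _ ε h1)
    filter_upwards [self_mem_nhdsWithin] with a ha
    have ha : 0 < a := ha
    have : 0 < (1 + a)⁻¹ := by positivity
    have := mul_pos hε this
    simp only [hg]
    linarith
  refine ⟨αb, ⟨?_, ?_, hα0, fun M => ⟨max M 0, le_max_right _ _, ?_⟩⟩, hge, ?_⟩
  · intro a ha
    rcases (show 0 ≤ a from ha).eq_or_lt with rfl | ha
    · rw [← Ioi_insert, continuousWithinAt_insert_self, ContinuousWithinAt, hα0]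
      refine Tendsto.congr' (f₁ := fun a => Real.exp (H.symm (g a))) ?_
        (Real.tendsto_exp_atBot.comp (H.symm.tendsto_atBot.comp hgbot))
      filter_upwards [self_mem_nhdsWithin] with a ha using (hαpos ha).symm
    · have hβa : ContinuousAt β a := hβc.continuousAt (Ici_mem_nhds ha)
      have hga : ContinuousAt g a :=
        (H.continuous.continuousAt.comp (hβa.log (hβpos ha).ne')).add
          (continuousAt_const.mul (continuousAt_const.sub
            ((continuousAt_const.add continuousAt_id).inv₀ (add_pos one_pos ha).ne')))
      have hca : ContinuousAt (fun a => Real.exp (H.symm (g a))) a :=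
        (H.symm.continuous.continuousAt.comp hga).rexp
      refine (hca.congr ?_).continuousWithinAt
      filter_upwards [Ioi_mem_nhds ha] with b hb using (hαpos hb).symm
  · intro a ha b hb hab
    have hb : 0 < b := (show 0 ≤ a from ha).trans_lt hab
    rw [hαpos hb]
    rcases (show 0 ≤ a from ha).eq_or_lt with rfl | ha
    · rw [hα0]
      exact Real.exp_pos _
    · rw [hαpos ha]
      exact Real.exp_lt_exp.2 (H.symm.strictMono (hgmono ha hb hab))
  · exact (le_max_left _ _).trans ((hβid _ (le_max_right _ _)).trans (hge _ (le_max_right _ _)))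
  · intro a ha
    have h1 := hH (Real.log (β a))
    have h2 := hH (H.symm (g a))
    rw [hexp ha] at h1
    rw [← hαpos ha, H.apply_symm_apply] at h2
    have hadd := hφ.integral_inv_add one_pos (hβpos ha)
      ((hβpos ha).trans_le (hge a ha.le))
    have h3 : 0 < ε * (1 + a)⁻¹ := by positivity
    have h4 : g a = H (Real.log (β a)) + ε - ε * (1 + a)⁻¹ := by simp only [hg]; ring
    linarith [hlog ha]

/-- The larger of the identity and the running maximum of a positive definite function. -/
lemma PosDef.exists_monotoneOn_ge (hα : PosDef α) :
    ∃ β : ℝ → ℝ, ContinuousOn β (Ici 0) ∧ MonotoneOn β (Ici 0) ∧ β 0 = 0 ∧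
      (∀ a, 0 ≤ a → a ≤ β a) ∧ (∀ a, 0 ≤ a → α a ≤ β a) ∧
      ∀ a, 0 < a → β a = a ∨ ∃ c, 0 < c ∧ c ≤ a ∧ β a = α c := by
  set f : ℝ → ℝ → ℝ := fun a t => α (max (t * a) 0) with hf
  have hfc : Continuous (Function.uncurry f) :=
    hα.1.comp_continuous (by fun_prop) fun x => mem_Ici.2 (le_max_right _ _)
  set m : ℝ → ℝ := fun a => sSup (f a '' Icc 0 1) with hm
  have hmc : Continuous m := isCompact_Icc.continuous_sSup hfc
  have hfa : ∀ a, ContinuousOn (f a) (Icc 0 1) := fun a =>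
    (hfc.comp (Continuous.prodMk_right a)).continuousOn
  have hval : ∀ {a t : ℝ}, 0 ≤ a → 0 ≤ t → f a t = α (t * a) := fun ha ht => by
    simp only [hf, max_eq_left (mul_nonneg ht ha)]
  have hle : ∀ {c a : ℝ}, 0 ≤ c → c ≤ a → α c ≤ m a := by
    intro c a hc hca
    refine le_csSup (isCompact_Icc.image_of_continuousOn (hfa a)).bddAbove
      ⟨c / a, ⟨div_nonneg hc (hc.trans hca), div_le_one_of_le₀ hca (hc.trans hca)⟩, ?_⟩
    rw [hval (hc.trans hca) (div_nonneg hc (hc.trans hca)), div_mul_cancel_of_imp]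
    rintro rfl
    exact le_antisymm hca hc
  have hatt : ∀ {a : ℝ}, 0 ≤ a → ∃ c, 0 ≤ c ∧ c ≤ a ∧ m a = α c := by
    intro a ha
    obtain ⟨t, ht, hmt, -⟩ := isCompact_Icc.exists_sSup_image_eq_and_ge
      (nonempty_Icc.2 zero_le_one) (hfa a)
    exact ⟨t * a, mul_nonneg ht.1 ha, mul_le_of_le_one_left ha ht.2,
      hmt.trans (hval ha ht.1)⟩
  refine ⟨fun a => max (m a) a, (hmc.max continuous_id).continuousOn, ?_, ?_,
    fun a _ => le_max_right _ _, fun a ha => (hle ha le_rfl).trans (le_max_left _ _), ?_⟩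
  · intro a ha b hb hab
    obtain ⟨c, hc, hca, h⟩ := hatt ha
    exact max_le_max (h.trans_le (hle hc (hca.trans hab))) hab
  · obtain ⟨c, hc, hca, h⟩ := hatt le_rfl
    obtain rfl := le_antisymm hca hc
    simp [h, hα.2.1]
  · intro a ha
    rcases le_total (m a) a with h | h
    · exact Or.inl (max_eq_right h)
    · obtain ⟨c, hc, hca, hmc⟩ := hatt ha.le
      refine Or.inr ⟨c, hc.lt_of_ne ?_, hca, (max_eq_left h).trans hmc⟩
      rintro rfl
      rw [hmc, hα.2.1] at h
      exact ha.not_ge h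

end PositiveDefinite

/-- Lemma 2(a): the positive definite `α` can be replaced by a `K∞` upper
bound keeping the integral condition. -/
theorem stmt15 (φ α p : ℝ → ℝ) (hφ : PosDef φ) (hα : PosDef α)
    (hp : LocIntegrable p) (hpnn : ∀ t : ℝ, 0 ≤ t → 0 ≤ p t)
    (θ : ℝ) (hθ : 0 < θ)
    (M : ℝ) (hM : M = sInf ((fun t => ∫ s in t..(t + θ), p s) '' Set.Ici 0))
    (hMpos : 0 < M)
    (hbdd : BddAbove ((fun a => ∫ s in a..(α a), (φ s)⁻¹) '' Set.Ioi 0))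
    (hlt : sSup ((fun a => ∫ s in a..(α a), (φ s)⁻¹) '' Set.Ioi 0) < M) :
    ∃ αb : ℝ → ℝ, ClassKInf αb ∧ (∀ a : ℝ, 0 ≤ a → α a ≤ αb a) ∧
      BddAbove ((fun a => ∫ s in a..(αb a), (φ s)⁻¹) '' Set.Ioi 0) ∧
      sSup ((fun a => ∫ s in a..(αb a), (φ s)⁻¹) '' Set.Ioi 0) < M := by
  set K := sSup ((fun a => ∫ s in a..(α a), (φ s)⁻¹) '' Set.Ioi 0)
  have hK : ∀ c, 0 < c → ∫ s in c..(α c), (φ s)⁻¹ ≤ K := fun c hc =>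
    le_csSup hbdd ⟨c, hc, rfl⟩
  have hKM : max K 0 < M := max_lt hlt hMpos
  obtain ⟨β, hβc, hβm, hβ0, hβid, hαβ, hβ⟩ := hα.exists_monotoneOn_ge
  obtain ⟨αb, hαb, hβαb, hint⟩ := hφ.exists_classKInf_ge hβc hβm hβ0 hβid
    (half_pos (sub_pos.2 hKM))
  have hbound : ∀ y ∈ (fun a => ∫ s in a..(αb a), (φ s)⁻¹) '' Set.Ioi 0,
      y ≤ max K 0 + (M - max K 0) / 2 := by
    rintro _ ⟨a, ha, rfl⟩
    have ha : 0 < a := ha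
    have hβa : 0 < β a := ha.trans_le (hβid a ha.le)
    have hβK : ∫ s in a..(β a), (φ s)⁻¹ ≤ max K 0 := by
      rcases hβ a ha with h | ⟨c, hc, hca, h⟩
      · rw [h, intervalIntegral.integral_same]
        exact le_max_right _ _
      · rw [h]
        have hadd := hφ.integral_inv_add hc ha (hα.2.2 c hc)
        have hnn := hφ.integral_inv_nonneg hc hca
        linarith [hK c hc, le_max_left K 0]
    have hadd := hφ.integral_inv_add ha hβa (hβa.trans_le (hβαb a ha.le))
    simp only
    linarith [hint a ha]
  refine ⟨αb, hαb, fun a ha => (hαβ a ha).trans (hβαb a ha), ⟨_, hbound⟩, ?_⟩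
  have := csSup_le (Set.nonempty_Ioi.image _) hbound
  linarith

end
end

section
/- Let φ̄ : [0,∞) → R be continuous with φ̄(0) = 0 and φ̄(r) < 0 for all r > 0, and assume ∫_1^∞ ds/(−φ̄(s)) = ∞ and lim_{r→0⁺} ∫_r^1 ds/(−φ̄(s)) = ∞. Define F : (0,∞) → R by F(r) = ∫_1^r ds/(−φ̄(s)); then F is a continuous strictly increasing bijection of (0,∞) onto R with inverse F⁻¹ : R → (0,∞). Let p : [0,∞) → [0,∞) be locally integrable, let θ > 0 and suppose M* := sup_{t≥0} ∫_t^{t+θ} p(s) ds < ∞. Then for each t_0 ≥ 0 and each ζ ≥ 0 the initial value problem ẇ(t) = −p(t) φ̄(w(t)), w(t_0) = ζ, has a unique forward-in-time solution w(·,t_0,ζ) defined on all of [t_0,∞), given by w(t,t_0,ζ) = F⁻¹(F(ζ) + ∫_{t_0}^t p(s) ds) if ζ > 0 and w(t,t_0,0) = 0; moreover, the function ν defined by ν(r) = F⁻¹(F(r) + M*) for r > 0 and ν(0) = 0 is of class K∞, and w(t,t_0,ζ) ≤ ν(ζ) for all t ∈ [t_0, t_0 + θ]. -/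
open MeasureTheory Filter Set
open scoped Classical

noncomputable section

/-- A Lipschitz function of an absolutely continuous function is absolutely continuous. -/
theorem absolutelyContinuousOnInterval_comp_of_lipschitzOnWith {G u : ℝ → ℝ} {a b : ℝ}
    {K : NNReal} (hG : LipschitzOnWith K G (u '' uIcc a b))
    (hu : AbsolutelyContinuousOnInterval u a b) :
    AbsolutelyContinuousOnInterval (G ∘ u) a b := by
  unfold AbsolutelyContinuousOnInterval at hu ⊢
  refine squeeze_zero' ?_ ?_ (by simpa using hu.const_mul (K : ℝ))
  · exact Eventually.of_forall fun _ => Finset.sum_nonneg fun _ _ => dist_nonneg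
  · rw [eventually_inf_principal]
    filter_upwards with E hE
    rw [Finset.mul_sum]
    refine Finset.sum_le_sum fun i hi => ?_
    exact hG.dist_le_mul _ (mem_image_of_mem u (hE.1 i hi).1) _ (mem_image_of_mem u (hE.1 i hi).2)

/-- The chain rule in integrated form for a `C¹` function of a primitive. -/
theorem integral_comp_mul_eq_sub {G g u q : ℝ → ℝ} {a b c d : ℝ} (hab : a ≤ b)
    (hq : IntervalIntegrable q volume a b)
    (hu : ∀ t ∈ Icc a b, u t = u a + ∫ s in a..t, q s)
    (hmaps : MapsTo u (Icc a b) (Icc c d))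
    (hG : ∀ x ∈ Icc c d, HasDerivAt G (g x) x) (hg : ContinuousOn g (Icc c d)) :
    ∫ s in a..b, g (u s) * q s = G (u b) - G (u a) := by
  set v : ℝ → ℝ := fun t => u a + ∫ s in a..t, q s with hv
  have huv : ∀ t ∈ Icc a b, v t = u t := fun t ht => (hu t ht).symm
  have hva : AbsolutelyContinuousOnInterval v a b := by
    have h1 : AbsolutelyContinuousOnInterval (fun _ : ℝ => u a) a b :=
      (LipschitzWith.const (u a)).lipschitzOnWith.absolutelyContinuousOnInterval
    exact h1.add (hq.absolutelyContinuousOnInterval_intervalIntegral left_mem_uIcc)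
  obtain ⟨C, hC⟩ := isCompact_Icc.exists_bound_of_continuousOn hg
  have hLip : LipschitzOnWith C.toNNReal G (Icc c d) := by
    refine (convex_Icc c d).lipschitzOnWith_of_nnnorm_hasDerivWithin_le
      (fun x hx => (hG x hx).hasDerivWithinAt) fun x hx => ?_
    rw [← NNReal.coe_le_coe, coe_nnnorm]
    exact (hC x hx).trans (Real.le_coe_toNNReal C)
  have hsub : v '' uIcc a b ⊆ Icc c d := by
    rintro _ ⟨t, ht, rfl⟩
    rw [uIcc_of_le hab] at ht
    rw [huv t ht]
    exact hmaps ht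
  have hac := absolutelyContinuousOnInterval_comp_of_lipschitzOnWith (hLip.mono hsub) hva
  have hftc := hac.integral_deriv_eq_sub
  simp only [Function.comp_apply] at hftc
  rw [huv b ⟨hab, le_rfl⟩, huv a ⟨le_rfl, hab⟩] at hftc
  rw [← hftc]
  refine intervalIntegral.integral_congr_ae ?_
  filter_upwards [hq.ae_hasDerivAt_integral] with t ht htab
  have htu : t ∈ uIcc a b := uIoc_subset_uIcc htab
  have htI : t ∈ Icc a b := by rwa [uIcc_of_le hab] at htu
  have hvd : HasDerivAt v (q t) t := (ht htu a left_mem_uIcc).const_add (u a)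
  have hGd : HasDerivAt G (g (u t)) (v t) := by
    rw [huv t htI]
    exact hG _ (hmaps htI)
  exact (hGd.comp t hvd).deriv.symm

theorem continuousOn_inv_of_pos {ψ : ℝ → ℝ} (hψ : ContinuousOn ψ (Ioi 0))
    (hpos : ∀ r : ℝ, 0 < r → 0 < ψ r) : ContinuousOn (fun s => (ψ s)⁻¹) (Ioi 0) :=
  hψ.inv₀ fun r hr => (hpos r hr).ne'

theorem intervalIntegrable_inv_of_pos {ψ : ℝ → ℝ} (hψ : ContinuousOn ψ (Ioi 0))
    (hpos : ∀ r : ℝ, 0 < r → 0 < ψ r) {a b : ℝ} (ha : 0 < a) (hb : 0 < b) :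
    IntervalIntegrable (fun s => (ψ s)⁻¹) volume a b :=
  ((continuousOn_inv_of_pos hψ hpos).mono fun _ hx =>
    (lt_min ha hb).trans_le hx.1).intervalIntegrable

theorem hasDerivAt_primitive_inv {ψ F : ℝ → ℝ} (hψ : ContinuousOn ψ (Ioi 0))
    (hpos : ∀ r : ℝ, 0 < r → 0 < ψ r) (hF : ∀ r : ℝ, F r = ∫ s in (1 : ℝ)..r, (ψ s)⁻¹)
    {r : ℝ} (hr : 0 < r) : HasDerivAt F (ψ r)⁻¹ r := by
  rw [funext hF]
  have hc := continuousOn_inv_of_pos hψ hpos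
  exact intervalIntegral.integral_hasDerivAt_right
    (intervalIntegrable_inv_of_pos hψ hpos one_pos hr)
    (hc.stronglyMeasurableAtFilter isOpen_Ioi r hr) (hc.continuousAt (Ioi_mem_nhds hr))

theorem strictMonoOn_primitive_inv {ψ F : ℝ → ℝ} (hψ : ContinuousOn ψ (Ioi 0))
    (hpos : ∀ r : ℝ, 0 < r → 0 < ψ r) (hF : ∀ r : ℝ, F r = ∫ s in (1 : ℝ)..r, (ψ s)⁻¹) :
    StrictMonoOn F (Ioi 0) := by
  refine strictMonoOn_of_deriv_pos (convex_Ioi 0)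
    (fun r hr => (hasDerivAt_primitive_inv hψ hpos hF hr).continuousAt.continuousWithinAt) ?_
  intro r hr
  rw [interior_Ioi] at hr
  rw [(hasDerivAt_primitive_inv hψ hpos hF hr).deriv]
  exact inv_pos.2 (hpos r hr)

theorem exists_lt_primitive_inv {ψ F : ℝ → ℝ} (hψ : ContinuousOn ψ (Ioi 0))
    (hpos : ∀ r : ℝ, 0 < r → 0 < ψ r) (hF : ∀ r : ℝ, F r = ∫ s in (1 : ℝ)..r, (ψ s)⁻¹)
    (hdiv : ¬ IntegrableOn (fun s => (ψ s)⁻¹) (Ici 1)) (M : ℝ) : ∃ r : ℝ, 0 < r ∧ M < F r := by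
  by_contra! hM
  refine hdiv ((integrableOn_Ici_iff_integrableOn_Ioi (by finiteness)).2 ?_)
  refine integrableOn_Ioi_of_intervalIntegral_norm_bounded (b := fun i : ℝ => i) (l := atTop)
    M 1 (fun i => ?_) tendsto_id ?_
  · rcases le_total i 1 with h | h
    · simp [Ioc_eq_empty_of_le h]
    · exact (intervalIntegrable_iff_integrableOn_Ioc_of_le h).1
        (intervalIntegrable_inv_of_pos hψ hpos one_pos (one_pos.trans_le h))
  · filter_upwards [eventually_ge_atTop 1] with i hi
    refine le_trans (le_of_eq ?_) (hM i (one_pos.trans_le hi))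
    rw [hF]
    refine intervalIntegral.integral_congr fun s hs => ?_
    rw [uIcc_of_le hi] at hs
    exact Real.norm_of_nonneg (inv_pos.2 (hpos s (one_pos.trans_le hs.1))).le

theorem exists_primitive_inv_lt {ψ F : ℝ → ℝ} (hψ : ContinuousOn ψ (Ioi 0))
    (hpos : ∀ r : ℝ, 0 < r → 0 < ψ r) (hF : ∀ r : ℝ, F r = ∫ s in (1 : ℝ)..r, (ψ s)⁻¹)
    (hdiv : ¬ IntegrableOn (fun s => (ψ s)⁻¹) (Ioc 0 1)) (M : ℝ) : ∃ r : ℝ, 0 < r ∧ F r < M := by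
  by_contra! hM
  have hle : ∀ n : ℕ, 1 / ((n : ℝ) + 1) ≤ 1 := fun n => by
    rw [div_le_one (by positivity)]
    linarith [n.cast_nonneg (α := ℝ)]
  have hlt : ∀ n : ℕ, 0 < 1 / ((n : ℝ) + 1) := fun n => by positivity
  refine hdiv (integrableOn_Ioc_of_intervalIntegral_norm_bounded_left (I := -M)
    (a := fun n : ℕ => 1 / ((n : ℝ) + 1)) (fun n => ?_) tendsto_one_div_add_atTop_nhds_zero_nat ?_)
  · exact (intervalIntegrable_iff_integrableOn_Ioc_of_le (hle n)).1
      (intervalIntegrable_inv_of_pos hψ hpos (hlt n) one_pos)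
  · filter_upwards with n
    rw [← intervalIntegral.integral_of_le (hle n)]
    have h := hM _ (hlt n)
    rw [hF, intervalIntegral.integral_symm] at h
    refine le_trans (le_of_eq ?_) (le_neg_of_le_neg h)
    refine intervalIntegral.integral_congr fun s hs => ?_
    rw [uIcc_of_le (hle n)] at hs
    exact Real.norm_of_nonneg (inv_pos.2 (hpos s ((hlt n).trans_le hs.1))).le

theorem surjOn_primitive_inv {ψ F : ℝ → ℝ} (hψ : ContinuousOn ψ (Ioi 0))
    (hpos : ∀ r : ℝ, 0 < r → 0 < ψ r) (hF : ∀ r : ℝ, F r = ∫ s in (1 : ℝ)..r, (ψ s)⁻¹)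
    (hdiv1 : ¬ IntegrableOn (fun s => (ψ s)⁻¹) (Ici 1))
    (hdiv0 : ¬ IntegrableOn (fun s => (ψ s)⁻¹) (Ioc 0 1)) : SurjOn F (Ioi 0) univ := by
  intro y _
  obtain ⟨a, ha, hay⟩ := exists_primitive_inv_lt hψ hpos hF hdiv0 y
  obtain ⟨b, hb, hyb⟩ := exists_lt_primitive_inv hψ hpos hF hdiv1 y
  exact isPreconnected_Ioi.intermediate_value ha hb
    (fun r hr => (hasDerivAt_primitive_inv hψ hpos hF hr).continuousAt.continuousWithinAt)
    ⟨hay.le, hyb.le⟩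

theorem strictMono_of_rightInverse {F Finv : ℝ → ℝ} (hmono : StrictMonoOn F (Ioi 0))
    (hright : ∀ y : ℝ, 0 < Finv y ∧ F (Finv y) = y) : StrictMono Finv := by
  intro x y hxy
  rw [← hmono.lt_iff_lt (hright x).1 (hright y).1, (hright x).2, (hright y).2]
  exact hxy

theorem continuous_of_inverse {F Finv : ℝ → ℝ} (hmono : StrictMonoOn F (Ioi 0))
    (hleft : ∀ r : ℝ, 0 < r → Finv (F r) = r)
    (hright : ∀ y : ℝ, 0 < Finv y ∧ F (Finv y) = y) : Continuous Finv := by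
  refine continuous_iff_continuousAt.2 fun y => ?_
  refine continuousAt_of_monotoneOn_of_image_mem_nhds (s := univ)
    ((strictMono_of_rightInverse hmono hright).monotone.monotoneOn _) univ_mem ?_
  exact mem_of_superset (Ioi_mem_nhds (hright y).1) fun r hr => ⟨F r, mem_univ _, hleft r hr⟩

/-- Conjugating a translation by an increasing bijection of `(0,∞)` onto `ℝ` yields a class `K∞`
function. -/
theorem classKInf_of_conj_translation {F Finv ν : ℝ → ℝ} {M : ℝ} (hmono : StrictMonoOn F (Ioi 0))
    (hcont : ContinuousOn F (Ioi 0)) (hleft : ∀ r : ℝ, 0 < r → Finv (F r) = r)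
    (hright : ∀ y : ℝ, 0 < Finv y ∧ F (Finv y) = y) (hν0 : ν 0 = 0)
    (hν : ∀ r : ℝ, 0 < r → ν r = Finv (F r + M)) : ClassKInf ν := by
  have hinv := strictMono_of_rightInverse hmono hright
  have hνpos : ∀ r : ℝ, 0 < r → 0 < ν r := fun r hr => by
    rw [hν r hr]
    exact (hright _).1
  refine ⟨?_, ?_, hν0, ?_⟩
  · intro r hr
    rcases (mem_Ici.1 hr).eq_or_lt with rfl | hr0
    · rw [ContinuousWithinAt, hν0, tendsto_order]
      refine ⟨fun a ha => ?_, fun ε hε => ?_⟩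
      · filter_upwards [self_mem_nhdsWithin] with s hs
        rcases (mem_Ici.1 hs).eq_or_lt with rfl | hs0
        · rwa [hν0]
        · exact ha.trans (hνpos s hs0)
      · have hδ := (hright (F ε - M)).1
        filter_upwards [self_mem_nhdsWithin, nhdsWithin_le_nhds (Iio_mem_nhds hδ)] with s hs hsδ
        rcases (mem_Ici.1 hs).eq_or_lt with rfl | hs0
        · rwa [hν0]
        · have h := hmono hs0 hδ hsδ
          rw [(hright _).2] at h
          rw [hν s hs0, ← hleft ε hε]
          exact hinv (by linarith)
    · have hc : ContinuousAt (fun s => Finv (F s + M)) r :=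
        (continuous_of_inverse hmono hleft hright).continuousAt.comp
          ((hcont.continuousAt (Ioi_mem_nhds hr0)).add continuousAt_const)
      refine (hc.congr ?_).continuousWithinAt
      filter_upwards [Ioi_mem_nhds hr0] with s hs using (hν s hs).symm
  · intro r hr s _ hrs
    rcases (mem_Ici.1 hr).eq_or_lt with rfl | hr0
    · rw [hν0]
      exact hνpos s hrs
    · rw [hν r hr0, hν s (hr0.trans hrs)]
      have := hmono hr0 (hr0.trans hrs) hrs
      exact hinv (by linarith)
  · intro K
    have hK : (0 : ℝ) < max K 1 := lt_max_of_lt_right one_pos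
    refine ⟨Finv (F (max K 1) - M), (hright _).1.le, ?_⟩
    rw [hν _ (hright _).1, (hright _).2, sub_add_cancel, hleft _ hK]
    exact le_max_left _ _

theorem LocIntegrable.intervalIntegrable {p : ℝ → ℝ} (hp : LocIntegrable p) (a b : ℝ) :
    IntervalIntegrable p volume a b :=
  ⟨(hp a b).mono_set Ioc_subset_Icc_self, (hp b a).mono_set Ioc_subset_Icc_self⟩

theorem IsODESol.monotoneOn {rhs : ℝ → ℝ → ℝ} {t0 : ℝ} {T : EReal} {w : ℝ → ℝ}
    (hw : IsODESol rhs t0 T w) (hrhs : ∀ t : ℝ, t0 ≤ t → ∀ r : ℝ, 0 ≤ r → 0 ≤ rhs t r)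
    {t1 t2 : ℝ} (h1 : t0 ≤ t1) (h12 : t1 ≤ t2) (h2 : (t2 : EReal) < T) : w t1 ≤ w t2 := by
  rw [(hw.flow t1 t2 h1 h12 h2).2]
  refine le_add_of_nonneg_right (intervalIntegral.integral_nonneg h12 fun s hs => ?_)
  exact hrhs s (h1.trans hs.1) _
    (hw.nonneg s (h1.trans hs.1) ((EReal.coe_le_coe_iff.2 hs.2).trans_lt h2))

theorem IsODESol.continuousOn {rhs : ℝ → ℝ → ℝ} {t0 : ℝ} {T : EReal} {w : ℝ → ℝ}
    (hw : IsODESol rhs t0 T w) {t1 t2 : ℝ} (h1 : t0 ≤ t1) (h12 : t1 ≤ t2)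
    (h2 : (t2 : EReal) < T) : ContinuousOn w (Icc t1 t2) := by
  have hi := (hw.flow t1 t2 h1 h12 h2).1
  have hc := intervalIntegral.continuousOn_primitive_interval' hi left_mem_uIcc
  rw [uIcc_of_le h12] at hc
  refine (hc.const_add (w t1)).congr fun t ht => ?_
  exact (hw.flow t1 t h1 ht.1 ((EReal.coe_le_coe_iff.2 ht.2).trans_lt h2)).2

/-- Separation of variables along a positive solution. -/
theorem IsODESol.primitive_comp_eq {φ F p w : ℝ → ℝ} {t0 : ℝ} {T : EReal}
    (hw : IsODESol (fun s r => -(p s * φ r)) t0 T w)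
    (hφ : ContinuousOn φ (Ioi 0)) (hneg : ∀ r : ℝ, 0 < r → φ r < 0)
    (hF : ∀ r : ℝ, 0 < r → HasDerivAt F (-(φ r))⁻¹ r)
    (hrhs : ∀ t : ℝ, t0 ≤ t → ∀ r : ℝ, 0 ≤ r → 0 ≤ -(p t * φ r))
    {t1 t2 : ℝ} (h1 : t0 ≤ t1) (h12 : t1 ≤ t2) (h2 : (t2 : EReal) < T) (hpos : 0 < w t1) :
    F (w t2) = F (w t1) + ∫ s in t1..t2, p s := by
  have hlt : ∀ t : ℝ, t ≤ t2 → (t : EReal) < T := fun t ht =>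
    (EReal.coe_le_coe_iff.2 ht).trans_lt h2
  have hmaps : MapsTo w (Icc t1 t2) (Icc (w t1) (w t2)) := fun t ht =>
    ⟨hw.monotoneOn hrhs h1 ht.1 (hlt t ht.2), hw.monotoneOn hrhs (h1.trans ht.1) ht.2 h2⟩
  have hIcc : Icc (w t1) (w t2) ⊆ Ioi 0 := fun r hr => hpos.trans_le hr.1
  have h := integral_comp_mul_eq_sub (g := fun r => (-(φ r))⁻¹) h12 (hw.flow t1 t2 h1 h12 h2).1
    (fun t ht => (hw.flow t1 t h1 ht.1 (hlt t ht.2)).2) hmaps (fun r hr => hF r (hIcc hr))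
    ((hφ.neg.inv₀ fun r hr => (neg_pos.2 (hneg r hr)).ne').mono hIcc)
  rw [← sub_eq_iff_eq_add', ← h]
  refine intervalIntegral.integral_congr fun s hs => ?_
  rw [uIcc_of_le h12] at hs
  have hne : φ (w s) ≠ 0 := (hneg _ (hIcc (hmaps hs))).ne
  field_simp

/-- A solution starting at `0` stays at `0` when the primitive `F` is unbounded below near `0`. -/
theorem IsODESol.eq_zero_of_eq_zero {φ F Finv p w : ℝ → ℝ} {t0 : ℝ} {T : EReal}
    (hw : IsODESol (fun s r => -(p s * φ r)) t0 T w) (hp : LocIntegrable p)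
    (hpnn : ∀ t : ℝ, t0 ≤ t → 0 ≤ p t)
    (hφ : ContinuousOn φ (Ioi 0)) (hneg : ∀ r : ℝ, 0 < r → φ r < 0)
    (hF : ∀ r : ℝ, 0 < r → HasDerivAt F (-(φ r))⁻¹ r) (hmono : StrictMonoOn F (Ioi 0))
    (hright : ∀ y : ℝ, 0 < Finv y ∧ F (Finv y) = y)
    (hrhs : ∀ t : ℝ, t0 ≤ t → ∀ r : ℝ, 0 ≤ r → 0 ≤ -(p t * φ r))
    (h0 : w t0 = 0) {t : ℝ} (ht0 : t0 ≤ t) (htT : (t : EReal) < T) : w t = 0 := by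
  by_contra hne
  have hwt : 0 < w t := lt_of_le_of_ne (hw.nonneg t ht0 htT) (Ne.symm hne)
  set P := ∫ s in t0..t, p s with hP
  have hPnn : 0 ≤ P := intervalIntegral.integral_nonneg ht0 fun s hs => hpnn s hs.1
  obtain ⟨hrpos, hFr⟩ := hright (F (w t) - P - 1)
  set r := Finv (F (w t) - P - 1) with hr
  have hrw : r < w t := by
    rw [← hmono.lt_iff_lt hrpos hwt, hFr]
    linarith
  obtain ⟨s, hs, hsr⟩ := intermediate_value_Icc ht0 (hw.continuousOn le_rfl ht0 htT)
    (show r ∈ Icc (w t0) (w t) from ⟨by rw [h0]; exact hrpos.le, hrw.le⟩)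
  have hsep := hw.primitive_comp_eq hφ hneg hF hrhs hs.1 hs.2 htT (by rwa [hsr])
  have hsplit := intervalIntegral.integral_add_adjacent_intervals
    (hp.intervalIntegrable t0 s) (hp.intervalIntegrable s t)
  have hnn : 0 ≤ ∫ x in t0..s, p x := intervalIntegral.integral_nonneg hs.1 fun x hx => hpnn x hx.1
  rw [hsr, hFr] at hsep
  linarith

/-- The function obtained by separation of variables solves the equation. -/
theorem isODESol_of_inverse_primitive {φ F Finv p W : ℝ → ℝ} {t0 c : ℝ}
    (hp : LocIntegrable p) (hpnn : ∀ t : ℝ, t0 ≤ t → 0 ≤ p t)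
    (hφ : ContinuousOn φ (Ioi 0)) (hneg : ∀ r : ℝ, 0 < r → φ r < 0)
    (hF : ∀ r : ℝ, 0 < r → HasDerivAt F (-(φ r))⁻¹ r)
    (hright : ∀ y : ℝ, 0 < Finv y ∧ F (Finv y) = y) (hcont : Continuous Finv)
    (hW : ∀ t : ℝ, W t = Finv (c + ∫ s in t0..t, p s)) :
    IsODESol (fun s r => -(p s * φ r)) t0 (⊤ : EReal) W := by
  refine ⟨EReal.coe_lt_top t0, fun t _ _ => by rw [hW]; exact (hright _).1.le, ?_⟩
  intro t1 t2 h1 h12 _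
  have hsplit : ∀ t : ℝ, c + ∫ s in t0..t, p s = (c + ∫ s in t0..t1, p s) + ∫ s in t1..t, p s :=
    fun t => by
      rw [add_assoc, intervalIntegral.integral_add_adjacent_intervals
        (hp.intervalIntegrable t0 t1) (hp.intervalIntegrable t1 t)]
  set u : ℝ → ℝ := fun t => c + ∫ s in t0..t, p s with hu
  have hWu : ∀ t : ℝ, W t = Finv (u t) := hW
  have hderiv : ∀ y : ℝ, HasDerivAt Finv (-(φ (Finv y))) y := fun y => by
    have hy := (hright y).1
    have h := (hF _ hy).of_local_left_inverse hcont.continuousAt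
      (inv_ne_zero (neg_pos.2 (hneg _ hy)).ne') (Eventually.of_forall fun z => (hright z).2)
    rwa [inv_inv] at h
  have hgc : Continuous fun y => -(φ (Finv y)) :=
    continuous_iff_continuousAt.2 fun y =>
      ((hφ.continuousAt (Ioi_mem_nhds (hright y).1)).comp (hcont.continuousAt)).neg
  have huc : ContinuousOn u (uIcc t1 t2) := by
    have hc := intervalIntegral.continuousOn_primitive_interval' (hp.intervalIntegrable t1 t2)
      left_mem_uIcc
    exact (hc.const_add _).congr fun t _ => hsplit t
  have hle : ∀ t ∈ Icc t1 t2, ∀ t' ∈ Icc t1 t2, t ≤ t' → u t ≤ u t' := by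
    intro t ht t' _ htt'
    have hadj := intervalIntegral.integral_add_adjacent_intervals
      (hp.intervalIntegrable t0 t) (hp.intervalIntegrable t t')
    have hnn : 0 ≤ ∫ s in t..t', p s :=
      intervalIntegral.integral_nonneg htt' fun s hs => hpnn s (h1.trans (ht.1.trans hs.1))
    simp only [hu]
    linarith
  have hmaps : MapsTo u (Icc t1 t2) (Icc (u t1) (u t2)) := fun t ht =>
    ⟨hle _ ⟨le_rfl, h12⟩ _ ht ht.1, hle _ ht _ ⟨h12, le_rfl⟩ ht.2⟩
  have hrw : (fun s => -(p s * φ (W s))) = fun s => -(φ (Finv (u s))) * p s := by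
    funext s
    rw [hWu]
    ring
  have hint := integral_comp_mul_eq_sub h12 (hp.intervalIntegrable t1 t2)
    (fun t _ => hsplit t) hmaps (fun y _ => hderiv y) hgc.continuousOn
  simp only [hrw]
  refine ⟨(hp.intervalIntegrable t1 t2).continuousOn_mul (hgc.comp_continuousOn huc), ?_⟩
  rw [hint, hWu, hWu]
  ring

/-- Claim 1 in the proof of Theorem 6: existence, uniqueness, explicit formula
and one-period bound for the scalar ODE `ẇ = −p(t)·φ̄(w)`. -/
theorem stmt17 (φb : ℝ → ℝ) (hφbc : ContinuousOn φb (Set.Ici 0)) (hφb0 : φb 0 = 0)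
    (hφbneg : ∀ r : ℝ, 0 < r → φb r < 0)
    (hdiv1 : ¬ MeasureTheory.IntegrableOn (fun s => (-(φb s))⁻¹) (Set.Ici 1))
    (hdiv0 : ¬ MeasureTheory.IntegrableOn (fun s => (-(φb s))⁻¹) (Set.Ioc 0 1))
    (F : ℝ → ℝ) (hF : ∀ r : ℝ, F r = ∫ s in (1 : ℝ)..r, (-(φb s))⁻¹)
    (p : ℝ → ℝ) (hp : LocIntegrable p) (hpnn : ∀ t : ℝ, 0 ≤ t → 0 ≤ p t)
    (θ : ℝ) (hθ : 0 < θ)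
    (Mstar : ℝ) (hMs : Mstar = sSup ((fun t => ∫ s in t..(t + θ), p s) '' Set.Ici 0))
    (hMfin : BddAbove ((fun t => ∫ s in t..(t + θ), p s) '' Set.Ici 0)) :
    StrictMonoOn F (Set.Ioi 0) ∧ ContinuousOn F (Set.Ioi 0) ∧
    Set.BijOn F (Set.Ioi 0) Set.univ ∧
    ∃ Finv : ℝ → ℝ, (∀ r : ℝ, 0 < r → Finv (F r) = r) ∧
      (∀ y : ℝ, 0 < Finv y ∧ F (Finv y) = y) ∧
      (∀ ν : ℝ → ℝ, ν 0 = 0 → (∀ r : ℝ, 0 < r → ν r = Finv (F r + Mstar)) →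
        ClassKInf ν) ∧
      ∀ t0 ζ : ℝ, 0 ≤ t0 → 0 ≤ ζ →
        ∀ W : ℝ → ℝ,
          (∀ t : ℝ, W t = if ζ = 0 then 0 else Finv (F ζ + ∫ s in t0..t, p s)) →
          W t0 = ζ ∧
          IsODESol (fun s r => -(p s * φb r)) t0 (⊤ : EReal) W ∧
          (∀ (T : EReal) (w : ℝ → ℝ), IsODESol (fun s r => -(p s * φb r)) t0 T w →
            w t0 = ζ → ∀ t : ℝ, t0 ≤ t → (t : EReal) < T → w t = W t) ∧
          ∀ t : ℝ, t0 ≤ t → t ≤ t0 + θ →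
            W t ≤ (if ζ = 0 then 0 else Finv (F ζ + Mstar)) := by
  have hφc : ContinuousOn φb (Ioi 0) := hφbc.mono Ioi_subset_Ici_self
  have hψpos : ∀ r : ℝ, 0 < r → 0 < -(φb r) := fun r hr => neg_pos.2 (hφbneg r hr)
  have hderiv : ∀ r : ℝ, 0 < r → HasDerivAt F (-(φb r))⁻¹ r := fun r hr =>
    hasDerivAt_primitive_inv hφc.neg hψpos hF hr
  have hmono : StrictMonoOn F (Ioi 0) := strictMonoOn_primitive_inv hφc.neg hψpos hF
  have hcont : ContinuousOn F (Ioi 0) := fun r hr =>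
    (hderiv r hr).continuousAt.continuousWithinAt
  have hsurj : SurjOn F (Ioi 0) univ := surjOn_primitive_inv hφc.neg hψpos hF hdiv1 hdiv0
  refine ⟨hmono, hcont, ⟨mapsTo_univ _ _, hmono.injOn, hsurj⟩, ?_⟩
  choose Finv hright using fun y : ℝ => hsurj (mem_univ y)
  replace hright : ∀ y : ℝ, 0 < Finv y ∧ F (Finv y) = y := hright
  have hleft : ∀ r : ℝ, 0 < r → Finv (F r) = r := fun r hr =>
    hmono.injOn (hright _).1 hr (hright _).2
  refine ⟨Finv, hleft, hright, fun ν hν0 hν =>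
    classKInf_of_conj_translation hmono hcont hleft hright hν0 hν, ?_⟩
  intro t0 ζ ht0 hζ W hW
  have hpt : ∀ t : ℝ, t0 ≤ t → 0 ≤ p t := fun t ht => hpnn t (ht0.trans ht)
  have hrhs : ∀ t : ℝ, t0 ≤ t → ∀ r : ℝ, 0 ≤ r → 0 ≤ -(p t * φb r) := by
    intro t ht r hr
    rcases hr.eq_or_lt with rfl | hr
    · simp [hφb0]
    · exact neg_nonneg.2 (mul_nonpos_of_nonneg_of_nonpos (hpt t ht) (hφbneg r hr).le)
  rcases hζ.eq_or_lt with rfl | hζ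
  · have hW0 : ∀ t, W t = 0 := fun t => by rw [hW, if_pos rfl]
    refine ⟨hW0 t0, ⟨EReal.coe_lt_top t0, fun t _ _ => (hW0 t).ge, fun t1 t2 _ _ _ => ?_⟩, ?_, ?_⟩
    · simp [hW0, hφb0]
    · intro T w hw hw0 t ht htT
      rw [hW0]
      exact hw.eq_zero_of_eq_zero hp hpt hφc hφbneg hderiv hmono hright hrhs hw0 ht htT
    · intro t _ _
      rw [hW0, if_pos rfl]
  · replace hW : ∀ t, W t = Finv (F ζ + ∫ s in t0..t, p s) := fun t => by
      rw [hW, if_neg hζ.ne']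
    refine ⟨by rw [hW, intervalIntegral.integral_same, add_zero, hleft ζ hζ], ?_, ?_, ?_⟩
    · exact isODESol_of_inverse_primitive hp hpt hφc hφbneg hderiv hright
        (continuous_of_inverse hmono hleft hright) hW
    · intro T w hw hw0 t ht htT
      have hw0pos : 0 < w t0 := by rwa [hw0]
      have h := hw.primitive_comp_eq hφc hφbneg hderiv hrhs le_rfl ht htT hw0pos
      have hpos : 0 < w t := hw0pos.trans_le (hw.monotoneOn hrhs le_rfl ht htT)
      rw [hW, ← hw0, ← h, hleft _ hpos]
    · intro t ht htθ
      rw [hW, if_neg hζ.ne']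
      refine (strictMono_of_rightInverse hmono hright).monotone (add_le_add le_rfl ?_)
      have hsplit := intervalIntegral.integral_add_adjacent_intervals
        (hp.intervalIntegrable t0 t) (hp.intervalIntegrable t (t0 + θ))
      have hnn : 0 ≤ ∫ s in t..(t0 + θ), p s :=
        intervalIntegral.integral_nonneg htθ fun s hs => hpt s (ht.trans hs.1)
      have hsup : ∫ s in t0..(t0 + θ), p s ≤ Mstar := by
        rw [hMs]
        exact le_csSup hMfin ⟨t0, ht0, rfl⟩
      linarith

end
end
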